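/- The four-qubit W state cannot be recovered from its two-qubit marginal by a channel acting only on B: there exists no completely positive, trace-preserving linear map R : M₂(ℂ) → M₈(ℂ) (acting on factor B, with output identified with B⊗C⊗D) such that (id_A ⊗ R)(Tr_{CD} ρ_W₄) = ρ_W₄. -/

import Mathlib

open Matrix
open scoped ComplexOrder

noncomputable section

abbrev Q : Type := Fin 2
abbrev M2 : Type := Matrix Q Q ℂ
abbrev M4 : Type := Matrix (Q × Q) (Q × Q) ℂ
abbrev Q3 : Type := Q × Q × Q
abbrev Q4 : Type := Q × Q × Q × Q

/-- Matrix units `E i j = |i⟩⟨j|` on `ℂ²`. -/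
def MU (i j : Q) : M2 := fun k l => if k = i ∧ l = j then 1 else 0

/-- A linear map `R : M₂(ℂ) → M₄(ℂ)` is trace-preserving. -/
def TP (R : M2 →ₗ[ℂ] M4) : Prop := ∀ X : M2, (R X).trace = X.trace

/-- A linear map `R : M₂(ℂ) → M₄(ℂ)` is Hermitian-preserving. -/
def HP (R : M2 →ₗ[ℂ] M4) : Prop := ∀ X : M2, R Xᴴ = (R X)ᴴ

/-- Choi matrix `Σ_{ij} E_{ij} ⊗ R(E_{ij})` of `R : M₂(ℂ) → M₄(ℂ)`. -/
def Choi (R : M2 →ₗ[ℂ] M4) : Matrix Q3 Q3 ℂ := fun x y => R (MU x.1 y.1) x.2 y.2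

/-- Complete positivity: the Choi matrix is positive semidefinite. -/
def CP (R : M2 →ₗ[ℂ] M4) : Prop := (Choi R).PosSemidef

/-- The four-qubit W state vector. -/
def w4 : Q4 → ℂ := fun x =>
  if x = (0,0,0,1) ∨ x = (0,0,1,0) ∨ x = (0,1,0,0) ∨ x = (1,0,0,0) then 1/2 else 0

/-- `ρ_W₄ = |W₄⟩⟨W₄|`. -/
def rhoW4 : Matrix Q4 Q4 ℂ := vecMulVec w4 (star w4)

abbrev M8 : Type := Matrix Q3 Q3 ℂ

/-- Trace-preserving for maps `M₂(ℂ) → M₈(ℂ)`. -/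
def TP8 (R : M2 →ₗ[ℂ] M8) : Prop := ∀ X : M2, (R X).trace = X.trace

/-- Choi matrix of a map `M₂(ℂ) → M₈(ℂ)`. -/
def Choi8 (R : M2 →ₗ[ℂ] M8) : Matrix (Q × Q3) (Q × Q3) ℂ := fun x y => R (MU x.1 y.1) x.2 y.2

/-- Complete positivity for maps `M₂(ℂ) → M₈(ℂ)`. -/
def CP8 (R : M2 →ₗ[ℂ] M8) : Prop := (Choi8 R).PosSemidef

/-- Partial trace over the last two factors `C, D`. -/
def trCD (M : Matrix Q4 Q4 ℂ) : M4 := fun x y =>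
  ∑ c : Q, ∑ d : Q, M (x.1, x.2, c, d) (y.1, y.2, c, d)

/-- `(id_A ⊗ R)` applied to a two-qubit matrix on `A ⊗ B`, `R` acting on factor `B`
with output identified with `B ⊗ C ⊗ D`. -/
def idA8 (R : M2 →ₗ[ℂ] M8) (ρ : M4) : Matrix Q4 Q4 ℂ := fun x y =>
  ∑ b : Q, ∑ b' : Q, ρ (x.1, b) (y.1, b') * R (MU b b') x.2 y.2

/-- The four-qubit W state cannot be recovered from its `AB` marginal by a
CPTP channel acting only on `B`. -/
theorem stmt10 :
    ¬ ∃ R : M2 →ₗ[ℂ] M8, CP8 R ∧ TP8 R ∧ idA8 R (trCD rhoW4) = rhoW4 := by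
  rintro ⟨R, hCP, -, hR⟩
  -- `R(E₁₁)` has a nonnegative diagonal
  have hpos : 0 ≤ R (MU 1 1) (0,0,0) (0,0,0) := by
    have h := hCP.diag_nonneg (i := ((1 : Q), ((0,0,0) : Q3)))
    simpa [Choi8] using h
  -- the `A = 1` block fixes `R(E₀₀)` and the `A = 0` block then makes `R(E₁₁)` negative
  have h1 := congrFun (congrFun hR (1,0,0,0)) (1,0,0,0)
  have h0 := congrFun (congrFun hR (0,0,0,0)) (0,0,0,0)
  simp [idA8, trCD, rhoW4, vecMulVec, w4, Fin.sum_univ_two] at h1 h0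
  have h2 : R (MU 1 1) (0,0,0) (0,0,0) = -2 := by
    have hc : (starRingEnd ℂ) 2 = 2 := Complex.conj_ofNat 2
    rw [hc] at h0
    linear_combination 4 * h0 - 2 * h1
  rw [h2] at hpos
  have := (Complex.le_def.mp hpos).1
  norm_num at this
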